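/- Let a, b, c be real numbers satisfying 0 < a < 1, a²/2 < b < a/2, and 2b²/(3a) < c < (−a² + 2ab − 4b² + 2b)/(6(1−a)). Then there exists a C^∞ function f : ℝ → ℝ mapping [0,1] into [0,1] such that f(0) = 0, f(1) = 1, f'(x) > 0 for all x ∈ (0,1), I(f)(1) = a, I²(f)(1) = b, and I³(f)(1) = c. -/

import Mathlib

open Set

/-- The integral operator `I(f)(x) = ∫₀ˣ f(t) dt`. -/
noncomputable def I (f : ℝ → ℝ) : ℝ → ℝ := fun x => ∫ t in (0:ℝ)..x, f t

/-- The moment curve `s ↦ (s, s², s³)`. -/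
def momentCurve (s : ℝ) : ℝ × ℝ × ℝ := (s, s ^ 2, s ^ 3)

/-- The first three moments of the smooth probability densities on `[0, 1]`. -/
def densityMoments : Set (ℝ × ℝ × ℝ) :=
  {p | ∃ φ : ℝ → ℝ, ContDiff ℝ (⊤ : ℕ∞) φ ∧ (∀ x, 0 ≤ φ x) ∧ ∫ s in (0:ℝ)..1, φ s = 1 ∧
    ∫ s in (0:ℝ)..1, φ s • momentCurve s = p}

/-- The open region cut out by the strict Hankel determinant inequalities of the truncated
Hausdorff moment problem on `[0, 1]`. -/
def hankelRegion : Set (ℝ × ℝ × ℝ) :=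
  {p | 0 < p.1 ∧ p.1 < 1 ∧ p.1 ^ 2 < p.2.1 ∧ p.2.1 ^ 2 < p.1 * p.2.2 ∧
    (p.1 - p.2.1) ^ 2 < (1 - p.1) * (p.2.1 - p.2.2)}

lemma continuous_momentCurve : Continuous momentCurve := by
  unfold momentCurve; fun_prop

lemma isOpen_hankelRegion : IsOpen hankelRegion := by
  have h (f g : ℝ × ℝ × ℝ → ℝ) (hf : Continuous f) (hg : Continuous g) :
      IsOpen {p | f p < g p} := isOpen_lt hf hg
  exact (h _ _ (by fun_prop) (by fun_prop)).inter <| (h _ _ (by fun_prop) (by fun_prop)).inter <|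
    (h _ _ (by fun_prop) (by fun_prop)).inter <| (h _ _ (by fun_prop) (by fun_prop)).inter <|
    h _ _ (by fun_prop) (by fun_prop)

lemma convex_densityMoments : Convex ℝ densityMoments := by
  rintro _ ⟨φ, hφ, hφ0, hφ1, rfl⟩ _ ⟨ψ, hψ, hψ0, hψ1, rfl⟩ u v hu hv huv
  have hc := continuous_momentCurve
  have hφc := hφ.continuous
  have hψc := hψ.continuous
  refine ⟨fun s => u * φ s + v * ψ s, by fun_prop, fun x => ?_, ?_, ?_⟩
  · have := hφ0 x
    have := hψ0 x
    positivity
  · rw [intervalIntegral.integral_add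
      (Continuous.intervalIntegrable (by fun_prop) _ _)
      (Continuous.intervalIntegrable (by fun_prop) _ _)]
    simp [hφ1, hψ1, huv]
  · simp_rw [add_smul, mul_smul]
    rw [intervalIntegral.integral_add
      (Continuous.intervalIntegrable (by fun_prop) _ _)
      (Continuous.intervalIntegrable (by fun_prop) _ _)]
    simp only [intervalIntegral.integral_smul]

lemma momentCurve_mem_closure {x : ℝ} (hx : x ∈ Ioo (0:ℝ) 1) :
    momentCurve x ∈ closure densityMoments := by
  have hc := continuous_momentCurve
  rw [Metric.mem_closure_iff]
  intro ε hε
  obtain ⟨δ₁, hδ₁, h₁⟩ := Metric.continuousAt_iff.1 hc.continuousAt (ε / 2) (half_pos hε)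
  obtain ⟨δ₂, hδ₂, h₂⟩ := Metric.isOpen_iff.1 isOpen_Ioo x hx
  let β : ContDiffBump x :=
    ⟨min δ₁ δ₂ / 2, min δ₁ δ₂, by positivity, half_lt_self (by positivity)⟩
  have hsupp : Function.support (β.normed MeasureTheory.volume) = Metric.ball x (min δ₁ δ₂) :=
    β.support_normed_eq
  have hint : ∫ s in (0:ℝ)..1, β.normed MeasureTheory.volume s = 1 := by
    rw [intervalIntegral.integral_eq_integral_of_support_subset, β.integral_normed]
    rw [hsupp]
    exact ((Metric.ball_subset_ball (min_le_right _ _)).trans h₂).trans Ioo_subset_Ioc_self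
  have hβ : ContDiff ℝ (⊤ : ℕ∞) (β.normed MeasureTheory.volume) := β.contDiff_normed
  have hβc := hβ.continuous
  refine ⟨_, ⟨_, hβ, fun y => β.nonneg_normed y, hint, rfl⟩, ?_⟩
  have hsub : (∫ s in (0:ℝ)..1, β.normed MeasureTheory.volume s • momentCurve s) - momentCurve x =
      ∫ s in (0:ℝ)..1, β.normed MeasureTheory.volume s • (momentCurve s - momentCurve x) := by
    simp_rw [smul_sub]
    rw [intervalIntegral.integral_sub
      (Continuous.intervalIntegrable (by fun_prop) _ _)
      (Continuous.intervalIntegrable (by fun_prop) _ _),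
      intervalIntegral.integral_smul_const, hint, one_smul]
  rw [dist_comm, dist_eq_norm, hsub]
  have hle : ‖∫ s in (0:ℝ)..1, β.normed MeasureTheory.volume s • (momentCurve s - momentCurve x)‖ ≤
      ∫ s in (0:ℝ)..1, β.normed MeasureTheory.volume s * (ε / 2) := by
    refine intervalIntegral.norm_integral_le_of_norm_le zero_le_one
      (Filter.Eventually.of_forall fun s _ => ?_)
      (Continuous.intervalIntegrable (by fun_prop) _ _)
    rw [norm_smul, Real.norm_of_nonneg (β.nonneg_normed s)]
    by_cases hs : s ∈ Metric.ball x (min δ₁ δ₂)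
    · refine mul_le_mul_of_nonneg_left ?_ (β.nonneg_normed s)
      rw [← dist_eq_norm]
      exact (h₁ ((Metric.mem_ball.1 hs).trans_le (min_le_left _ _))).le
    · rw [← hsupp, Function.notMem_support] at hs
      simp [hs]
  rw [intervalIntegral.integral_mul_const, hint, one_mul] at hle
  linarith

/-- Gauss quadrature with two nodes: every point of the Hankel region is a convex combination of
two points of the moment curve. -/
lemma hankelRegion_subset_closure : hankelRegion ⊆ closure densityMoments := by
  rintro ⟨m₁, m₂, m₃⟩ ⟨h0, h1, h2, h3, h4⟩
  simp only at h0 h1 h2 h3 h4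
  have hD : 0 < m₂ - m₁ ^ 2 := by linarith
  obtain ⟨α, hα⟩ : ∃ α, α * (m₂ - m₁ ^ 2) = m₃ - m₁ * m₂ :=
    ⟨(m₃ - m₁ * m₂) / (m₂ - m₁ ^ 2), by field_simp⟩
  let q : ℝ → ℝ := fun x => x ^ 2 - α * x - (m₂ - α * m₁)
  have hqc : Continuous q := by fun_prop
  have hq0 : 0 < q 0 := by
    refine pos_of_mul_pos_left (b := m₂ - m₁ ^ 2) ?_ hD.le
    have : q 0 * (m₂ - m₁ ^ 2) = m₁ * m₃ - m₂ ^ 2 := by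
      simp only [q]; linear_combination m₁ * hα
    linarith
  have hq1 : 0 < q 1 := by
    refine pos_of_mul_pos_left (b := m₂ - m₁ ^ 2) ?_ hD.le
    have : q 1 * (m₂ - m₁ ^ 2) = (1 - m₁) * (m₂ - m₃) - (m₁ - m₂) ^ 2 := by
      simp only [q]; linear_combination (m₁ - 1) * hα
    linarith
  have hqm : q m₁ < 0 := by simp only [q]; linarith
  obtain ⟨x, hx, hqx⟩ := intermediate_value_Ioo' h0.le hqc.continuousOn ⟨hqm, hq0⟩
  obtain ⟨y, hy, hqy⟩ := intermediate_value_Ioo h1.le hqc.continuousOn ⟨hqm, hq1⟩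
  have hxy : 0 < y - x := by linarith [hx.2, hy.1]
  have hconv := convex_densityMoments.closure
    (momentCurve_mem_closure ⟨hx.1, hx.2.trans h1⟩)
    (momentCurve_mem_closure ⟨h0.trans hy.1, hy.2⟩)
    (div_nonneg (sub_nonneg.2 hy.1.le) hxy.le) (div_nonneg (sub_nonneg.2 hx.2.le) hxy.le)
    (by field_simp; ring)
  convert hconv using 1
  simp only [q] at hqx hqy
  have hx2 : x ^ 2 = α * x + (m₂ - α * m₁) := by linarith
  have hy2 : y ^ 2 = α * y + (m₂ - α * m₁) := by linarith
  have hx3 : x ^ 3 = α * (α * x + (m₂ - α * m₁)) + (m₂ - α * m₁) * x := by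
    linear_combination (x + α) * hx2
  have hy3 : y ^ 3 = α * (α * y + (m₂ - α * m₁)) + (m₂ - α * m₁) * y := by
    linear_combination (y + α) * hy2
  simp only [momentCurve, Prod.smul_mk, Prod.mk_add_mk, smul_eq_mul, Prod.mk.injEq]
  rw [hx2, hy2, hx3, hy3]
  refine ⟨?_, ?_, ?_⟩
  · field_simp; ring
  · field_simp; ring
  · field_simp
    linear_combination -(y - x) * hα

lemma hankelRegion_subset_densityMoments : hankelRegion ⊆ densityMoments := by
  rcases hankelRegion.eq_empty_or_nonempty with h | hne
  · simp [h]
  have hspan : affineSpan ℝ densityMoments = ⊤ := by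
    rw [eq_top_iff, ← isOpen_hankelRegion.affineSpan_eq_top hne, affineSpan_le]
    exact hankelRegion_subset_closure.trans
      ((AffineSubspace.closed_of_finiteDimensional _).closure_subset_iff.2
        (subset_affineSpan ℝ _))
  have hint := convex_densityMoments.interior_nonempty_iff_affineSpan_eq_top.2 hspan
  have := interior_maximal hankelRegion_subset_closure isOpen_hankelRegion
  rw [convex_densityMoments.interior_closure_eq_interior_of_nonempty_interior hint] at this
  exact this.trans interior_subset

/-- Mixing with the uniform density makes the density strictly positive. -/
lemma exists_pos_density {p : ℝ × ℝ × ℝ} (hp : p ∈ hankelRegion) :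
    ∃ φ : ℝ → ℝ, ContDiff ℝ (⊤ : ℕ∞) φ ∧ (∀ x, 0 < φ x) ∧ ∫ s in (0:ℝ)..1, φ s = 1 ∧
      ∫ s in (0:ℝ)..1, φ s • momentCurve s = p := by
  have hc := continuous_momentCurve
  let l := ∫ s in (0:ℝ)..1, momentCurve s
  have hcont : Continuous fun t : ℝ => p + t • (p - l) := by fun_prop
  have hnhds : ∀ᶠ t in nhdsWithin (0:ℝ) (Ioi 0), p + t • (p - l) ∈ hankelRegion :=
    (hcont.continuousAt.eventually
      (isOpen_hankelRegion.mem_nhds (by simpa using hp))).filter_mono nhdsWithin_le_nhds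
  obtain ⟨t, htp, ht : 0 < t⟩ := (hnhds.and self_mem_nhdsWithin).exists
  obtain ⟨φ, hφ, hφ0, hφ1, hφm⟩ := hankelRegion_subset_densityMoments htp
  have hφc := hφ.continuous
  refine ⟨fun s => (1 + t)⁻¹ * (φ s + t), by fun_prop, fun x => ?_, ?_, ?_⟩
  · have := hφ0 x
    positivity
  · rw [intervalIntegral.integral_const_mul, intervalIntegral.integral_add
      (Continuous.intervalIntegrable (by fun_prop) _ _)
      (Continuous.intervalIntegrable (by fun_prop) _ _), hφ1]
    simp
    field_simp
  · simp_rw [mul_smul, add_smul]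
    rw [intervalIntegral.integral_smul, intervalIntegral.integral_add
      (Continuous.intervalIntegrable (by fun_prop) _ _)
      (Continuous.intervalIntegrable (by fun_prop) _ _), hφm, intervalIntegral.integral_smul,
      inv_smul_eq_iff₀ (by positivity)]
    module

lemma hasDerivAt_I {f : ℝ → ℝ} (hf : Continuous f) (x : ℝ) : HasDerivAt (I f) (f x) x :=
  intervalIntegral.integral_hasDerivAt_right (hf.intervalIntegrable _ _)
    (hf.stronglyMeasurableAtFilter _ _) hf.continuousAt

lemma continuous_I {f : ℝ → ℝ} (hf : Continuous f) : Continuous (I f) :=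
  continuous_iff_continuousAt.2 fun x => (hasDerivAt_I hf x).continuousAt

lemma integral_pow_mul_I {f : ℝ → ℝ} (hf : Continuous f) (n : ℕ) :
    ∫ t in (0:ℝ)..1, (1 - t) ^ n * I f t =
      (∫ t in (0:ℝ)..1, (1 - t) ^ (n + 1) * f t) / (n + 1) := by
  have hn : (n + 1 : ℝ) ≠ 0 := by positivity
  have hd (t : ℝ) : HasDerivAt (fun t : ℝ => -(1 - t) ^ (n + 1) / (n + 1)) ((1 - t) ^ n) t := by
    have := ((((hasDerivAt_id t).const_sub 1).pow (n + 1)).neg).div_const (n + 1 : ℝ)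
    refine this.congr_deriv ?_
    simp
    field_simp
  have key := intervalIntegral.integral_deriv_mul_eq_sub (a := 0) (b := 1)
    (fun t _ => hd t) (fun t _ => hasDerivAt_I hf t)
    (Continuous.intervalIntegrable (by fun_prop) _ _) (hf.intervalIntegrable _ _)
  have hI := continuous_I hf
  rw [intervalIntegral.integral_add
      (Continuous.intervalIntegrable (by fun_prop) _ _)
      (Continuous.intervalIntegrable (by fun_prop) _ _)] at key
  have h0 : I f 0 = 0 := by simp [I]
  have hneg : ∫ t in (0:ℝ)..1, -(1 - t) ^ (n + 1) / (n + 1) * f t =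
      -((∫ t in (0:ℝ)..1, (1 - t) ^ (n + 1) * f t) / (n + 1)) := by
    rw [← intervalIntegral.integral_div, ← intervalIntegral.integral_neg]
    congr 1 with t
    ring
  rw [hneg, h0] at key
  simp at key
  linarith

lemma I_I_one {f : ℝ → ℝ} (hf : Continuous f) :
    I (I f) 1 = ∫ t in (0:ℝ)..1, (1 - t) * f t := by
  simpa [I] using integral_pow_mul_I hf 0

lemma I_I_I_one {f : ℝ → ℝ} (hf : Continuous f) :
    I (I (I f)) 1 = (∫ t in (0:ℝ)..1, (1 - t) ^ 2 * f t) / 2 := by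
  rw [I_I_one (continuous_I hf)]
  have := integral_pow_mul_I hf 1
  norm_num at this
  exact this

lemma I_I_I_I_one {f : ℝ → ℝ} (hf : Continuous f) :
    I (I (I (I f))) 1 = (∫ t in (0:ℝ)..1, (1 - t) ^ 3 * f t) / 6 := by
  rw [I_I_I_one (continuous_I hf)]
  have := integral_pow_mul_I hf 2
  norm_num at this
  rw [this]
  ring

theorem stmt2 (a b c : ℝ)
    (ha0 : 0 < a) (ha1 : a < 1)
    (hb1 : a ^ 2 / 2 < b) (hb2 : b < a / 2)
    (hc1 : 2 * b ^ 2 / (3 * a) < c)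
    (hc2 : c < (-a ^ 2 + 2 * a * b - 4 * b ^ 2 + 2 * b) / (6 * (1 - a))) :
    ∃ f : ℝ → ℝ, ContDiff ℝ (⊤ : ℕ∞) f ∧
      (∀ x ∈ Icc (0:ℝ) 1, f x ∈ Icc (0:ℝ) 1) ∧
      f 0 = 0 ∧ f 1 = 1 ∧
      (∀ x ∈ Ioo (0:ℝ) 1, 0 < deriv f x) ∧
      I f 1 = a ∧ I (I f) 1 = b ∧ I (I (I f)) 1 = c := by
  have hp : (a, 2 * b, 6 * c) ∈ hankelRegion := by
    rw [div_lt_iff₀ (by positivity)] at hc1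
    rw [lt_div_iff₀ (by linarith)] at hc2
    refine ⟨ha0, ha1, ?_, ?_, ?_⟩ <;> simp only <;> nlinarith
  obtain ⟨φ, hφ, hφ0, hφ1, hφm⟩ := exists_pos_density hp
  have hφc := hφ.continuous
  have hc := continuous_momentCurve
  have hint : IntervalIntegrable (fun s => φ s • momentCurve s) MeasureTheory.volume 0 1 :=
    Continuous.intervalIntegrable (by fun_prop) _ _
  have hm (L : ℝ × ℝ × ℝ →L[ℝ] ℝ) :
      ∫ s in (0:ℝ)..1, L (momentCurve s) * φ s = L (a, 2 * b, 6 * c) := by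
    rw [← hφm, ← L.intervalIntegral_comp_comm hint]
    simp [mul_comm]
  have hrefl (k : ℕ) : ∫ t in (0:ℝ)..1, (1 - t) ^ k * φ (1 - t) = ∫ s in (0:ℝ)..1, s ^ k * φ s := by
    simpa using intervalIntegral.integral_comp_sub_left (a := 0) (b := 1)
      (fun s : ℝ => s ^ k * φ s) 1
  have m1 := hm (.fst ℝ ℝ _)
  have m2 := hm ((ContinuousLinearMap.fst ℝ ℝ ℝ).comp (.snd ℝ ℝ _))
  have m3 := hm ((ContinuousLinearMap.snd ℝ ℝ ℝ).comp (.snd ℝ ℝ _))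
  simp [momentCurve] at m1 m2 m3
  let g : ℝ → ℝ := fun t => φ (1 - t)
  have hg : ContDiff ℝ (⊤ : ℕ∞) g := by fun_prop
  have hgc := hg.continuous
  have hderiv : deriv (I g) = g := funext fun x => (hasDerivAt_I hgc x).deriv
  have hmono : Monotone (I g) :=
    monotone_of_deriv_nonneg (fun x => (hasDerivAt_I hgc x).differentiableAt) fun x => by
      rw [hderiv]; exact (hφ0 _).le
  have h0 : I g 0 = 0 := by simp [I]
  have h1 : I g 1 = 1 := by
    have := hrefl 0
    simp only [pow_zero, one_mul, hφ1] at this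
    exact this
  refine ⟨I g, ?_, fun x hx => ⟨?_, ?_⟩, h0, h1, fun x _ => ?_, ?_, ?_, ?_⟩
  · rw [contDiff_infty_iff_deriv, hderiv]
    exact ⟨fun x => (hasDerivAt_I hgc x).differentiableAt, hg⟩
  · exact h0 ▸ hmono hx.1
  · exact h1 ▸ hmono hx.2
  · rw [hderiv]
    exact hφ0 _
  · have := hrefl 1
    rw [I_I_one hgc]
    simp only [pow_one] at this
    rw [this, m1]
  · rw [I_I_I_one hgc, hrefl 2, m2]
    ring
  · rw [I_I_I_I_one hgc, hrefl 3, m3]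
    ring
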